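/- Let ξ < −1/4 and let φ ∈ (0, π/4) satisfy √(2(cos 2φ + 1)) > −1 + √(1 − 2/ξ). Then there exists a constant c < 0 (depending only on ξ and φ) such that Im θ_ξ(k) ≤ c·(Im k) for every k = u + iv with v ≥ 0 and v ≤ |u| tan φ (k ∈ Υ₁ ∪ Υ₂), and Im θ_ξ(k) ≥ c·(Im k) for every k = u + iv with v ≤ 0 and |v| ≤ |u| tan φ (k ∈ Υ₃ ∪ Υ₄). -/

import Mathlib

/-- The phase function of the Camassa–Holm Riemann–Hilbert problem:
`θ_ξ(k) = kξ − k/(2k² + 1/2)`. -/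
noncomputable def thetaCH (ξ : ℝ) (k : ℂ) : ℂ :=
  k * (ξ : ℂ) - k / (2 * k ^ 2 + 1 / 2)

theorem thetaCH_im (ξ u v : ℝ) :
    (thetaCH ξ (u + v * Complex.I)).im =
      (ξ + 2 * (4 * (u ^ 2 + v ^ 2) - 1) /
        (16 * (u ^ 2 + v ^ 2) ^ 2 + 8 * (u ^ 2 - v ^ 2) + 1)) * v := by
  have hre : (2 * ((u : ℂ) + v * Complex.I) ^ 2 + 1 / 2).re = 2 * (u ^ 2 - v ^ 2) + 1 / 2 := by
    norm_num [pow_two]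
  have him : (2 * ((u : ℂ) + v * Complex.I) ^ 2 + 1 / 2).im = 4 * u * v := by
    norm_num [pow_two]
    ring
  have hn : (2 * (u ^ 2 - v ^ 2) + 1 / 2) * (2 * (u ^ 2 - v ^ 2) + 1 / 2) + 4 * u * v * (4 * u * v)
      = (16 * (u ^ 2 + v ^ 2) ^ 2 + 8 * (u ^ 2 - v ^ 2) + 1) / 4 := by ring
  rw [thetaCH, Complex.sub_im, Complex.div_im, Complex.normSq_apply, hre, him, hn]
  simp only [Complex.mul_im, Complex.add_re, Complex.add_im, Complex.mul_re, Complex.ofReal_re,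
    Complex.ofReal_im, Complex.I_re, Complex.I_im]
  field_simp
  ring

/-- In the sector of half-angle `φ` around the real axis, `Re k² ≥ cos 2φ · |k|²`. -/
theorem cos_two_mul_mul_le_sq_sub_sq {φ u v : ℝ} (hφ : 0 < Real.cos φ)
    (h : |v| ≤ |u| * Real.tan φ) :
    Real.cos (2 * φ) * (u ^ 2 + v ^ 2) ≤ u ^ 2 - v ^ 2 := by
  have h1 : |v| * Real.cos φ ≤ |u| * Real.sin φ := by
    have := mul_le_mul_of_nonneg_right h hφ.le
    rwa [mul_assoc, Real.tan_mul_cos hφ.ne'] at this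
  have h2 : v ^ 2 * Real.cos φ ^ 2 ≤ u ^ 2 * Real.sin φ ^ 2 := by
    have := pow_le_pow_left₀ (by positivity) h1 2
    simpa only [mul_pow, sq_abs] using this
  rw [Real.sin_sq] at h2
  rw [Real.cos_two_mul]
  linarith

theorem two_mul_div_le_of_mul_le {q r w : ℝ} (hq : 0 < q)
    (hw : (q ^ 2 / 2 - 1) * r ≤ w) (hD : 0 < 16 * r ^ 2 + 8 * w + 1) :
    2 * (4 * r - 1) / (16 * r ^ 2 + 8 * w + 1) ≤ 2 / (q ^ 2 + 2 * q) := by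
  rw [div_le_div_iff₀ hD (by positivity)]
  nlinarith [sq_nonneg (4 * r - 1 - q)]

/-- For `ξ < −1/4` and `φ ∈ (0, π/4)` with
`√(2(cos 2φ + 1)) > −1 + √(1 − 2/ξ)`, there is a constant `c < 0` such that
`Im θ_ξ(k) ≤ c·(Im k)` on `Υ₁ ∪ Υ₂` (`v ≥ 0`, `v ≤ |u| tan φ`) and
`Im θ_ξ(k) ≥ c·(Im k)` on `Υ₃ ∪ Υ₄` (`v ≤ 0`, `|v| ≤ |u| tan φ`). -/
theorem stmt_4 (ξ φ : ℝ) (hξ : ξ < -(1 / 4)) (hφ : φ ∈ Set.Ioo 0 (Real.pi / 4))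
    (hcond : Real.sqrt (2 * (Real.cos (2 * φ) + 1)) > -1 + Real.sqrt (1 - 2 / ξ)) :
    ∃ c : ℝ, c < 0 ∧
      (∀ u v : ℝ, 0 ≤ v → v ≤ |u| * Real.tan φ →
        (thetaCH ξ (u + v * Complex.I)).im ≤ c * v) ∧
      (∀ u v : ℝ, v ≤ 0 → |v| ≤ |u| * Real.tan φ →
        (thetaCH ξ (u + v * Complex.I)).im ≥ c * v) := by
  have hξ0 : ξ < 0 := by linarith
  have hcos : 0 < Real.cos φ :=
    Real.cos_pos_of_mem_Ioo ⟨by linarith [hφ.1, Real.pi_pos], by linarith [hφ.2, Real.pi_pos]⟩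
  have hcos2 : 0 < Real.cos (2 * φ) :=
    Real.cos_pos_of_mem_Ioo ⟨by linarith [hφ.1, Real.pi_pos], by linarith [hφ.2]⟩
  set q := Real.sqrt (2 * (Real.cos (2 * φ) + 1))
  have hq : 0 < q := Real.sqrt_pos.2 (by linarith)
  have hq2 : q ^ 2 = 2 * (Real.cos (2 * φ) + 1) := Real.sq_sqrt (by linarith)
  have hlt : 1 - 2 / ξ < (q + 1) ^ 2 := (Real.sqrt_lt' (by linarith)).1 (by linarith)
  have hc : ξ + 2 / (q ^ 2 + 2 * q) < 0 := by
    have h1 : 2 / -ξ < q ^ 2 + 2 * q := by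
      rw [div_neg]
      linarith
    have h2 := (div_lt_comm₀ (neg_pos.2 hξ0) (by positivity)).1 h1
    linarith
  have key : ∀ u v : ℝ, |v| ≤ |u| * Real.tan φ →
      ∃ g ≤ ξ + 2 / (q ^ 2 + 2 * q), (thetaCH ξ (u + v * Complex.I)).im = g * v := by
    intro u v h
    have hw := cos_two_mul_mul_le_sq_sub_sq hcos h
    have hD : 0 < 16 * (u ^ 2 + v ^ 2) ^ 2 + 8 * (u ^ 2 - v ^ 2) + 1 := by
      have : 0 ≤ Real.cos (2 * φ) * (u ^ 2 + v ^ 2) := by positivity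
      nlinarith [sq_nonneg (u ^ 2 + v ^ 2)]
    refine ⟨_, ?_, thetaCH_im ξ u v⟩
    have := two_mul_div_le_of_mul_le hq
      (by rw [hq2]; linarith : (q ^ 2 / 2 - 1) * (u ^ 2 + v ^ 2) ≤ u ^ 2 - v ^ 2) hD
    linarith
  refine ⟨_, hc, fun u v hv h => ?_, fun u v hv h => ?_⟩
  · obtain ⟨g, hg, he⟩ := key u v (by rwa [abs_of_nonneg hv])
    rw [he]
    exact mul_le_mul_of_nonneg_right hg hv
  · obtain ⟨g, hg, he⟩ := key u v h
    rw [he]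
    exact mul_le_mul_of_nonpos_right hg hv
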